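/- Influence function of the GSSCM functional: Let F be a probability measure on ℝᵖ, x ∈ ℝᵖ, and let G : ℝ × ℝᵖ → ℝᵖ be measurable in its second argument. Define Σ(ε) = (1−ε)∫ G(ε,y)G(ε,y)ᵀ dF(y) + ε·G(ε,x)G(ε,x)ᵀ (the GSSCM functional evaluated at the contaminated distribution F_{ε,x}, whose radial map is G(ε,·)). Write g = G(0,·). Assume: (i) for F-almost every y and for y = x, the map ε ↦ G(ε,y) is differentiable on a neighborhood (−δ,δ) of 0; write dge(y) = ∂_ε G(ε,y)|_{ε=0}; (ii) there is an F-integrable function M with ‖∂_ε(G(ε,y)G(ε,y)ᵀ)‖ ≤ M(y) for all |ε| < δ and F-almost every y; (iii) y ↦ g(y)g(y)ᵀ and y ↦ dge(y)g(y)ᵀ are F-integrable. Then ε ↦ Σ(ε) is differentiable at 0 and Σ'(0) = g(x)g(x)ᵀ − Σ(0) + ∫ ( dge(y) g(y)ᵀ + g(y) dge(y)ᵀ ) dF(y). -/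

import Mathlib

open MeasureTheory Matrix

/-- **Influence function of the GSSCM functional**: with
`Σ(ε)ᵢⱼ = (1−ε) ∫ G(ε,y)ᵢ G(ε,y)ⱼ dF(y) + ε G(ε,x)ᵢ G(ε,x)ⱼ` (the GSSCM at the
contaminated distribution `F_{ε,x}`), under differentiability and domination
hypotheses the map `ε ↦ Σ(ε)` is differentiable (entrywise) at `0` with
`Σ'(0) = g(x)g(x)ᵀ − Σ(0) + ∫ (dge(y) g(y)ᵀ + g(y) dge(y)ᵀ) dF(y)`, where
`g = G(0,·)` and `dge(y) = ∂_ε G(ε,y)|_{ε=0}`. -/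
theorem gsscm_influence_function {p : ℕ}
    (F : Measure (Fin p → ℝ)) [IsProbabilityMeasure F]
    (x : Fin p → ℝ)
    (G : ℝ → (Fin p → ℝ) → (Fin p → ℝ))
    (hGmeas : ∀ ε, Measurable (G ε))
    (δ : ℝ) (hδ : 0 < δ)
    (D : ℝ → (Fin p → ℝ) → (Fin p → ℝ))
    (hDmeas : ∀ ε, Measurable (D ε))
    -- (i) for F-a.e. y, and for y = x, ε ↦ G(ε,y) is differentiable on (−δ,δ)
    (hdiff : ∀ᵐ y ∂F, ∀ ε ∈ Set.Ioo (-δ) δ, HasDerivAt (fun e => G e y) (D ε y) ε)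
    (hdiffx : ∀ ε ∈ Set.Ioo (-δ) δ, HasDerivAt (fun e => G e x) (D ε x) ε)
    -- (ii) domination of the entrywise derivative of G(ε,y)G(ε,y)ᵀ
    (M : (Fin p → ℝ) → ℝ) (hM : Integrable M F)
    (hdom : ∀ i j : Fin p, ∀ᵐ y ∂F, ∀ ε ∈ Set.Ioo (-δ) δ,
      |D ε y i * G ε y j + G ε y i * D ε y j| ≤ M y)
    -- (iii) integrability of g gᵀ and dge gᵀ
    (hint1 : ∀ i j : Fin p, Integrable (fun y => G 0 y i * G 0 y j) F)
    (hint2 : ∀ i j : Fin p, Integrable (fun y => D 0 y i * G 0 y j) F) :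
    ∀ i j : Fin p,
      HasDerivAt
        (fun ε => (1 - ε) * (∫ y, G ε y i * G ε y j ∂F) + ε * (G ε x i * G ε x j))
        (G 0 x i * G 0 x j - (∫ y, G 0 y i * G 0 y j ∂F)
          + ∫ y, (D 0 y i * G 0 y j + G 0 y i * D 0 y j) ∂F) 0 := by
  intro i j
  have hcoord_meas : ∀ {f : (Fin p → ℝ) → Fin p → ℝ}, Measurable f →
      ∀ k, Measurable fun y => f y k :=
    fun hf k => (measurable_pi_apply k).comp hf
  have h_integral : HasDerivAt (fun ε => ∫ y, G ε y i * G ε y j ∂F)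
      (∫ y, (D 0 y i * G 0 y j + G 0 y i * D 0 y j) ∂F) 0 := by
    refine (hasDerivAt_integral_of_dominated_loc_of_deriv_le (bound := M)
      (F := fun ε y => G ε y i * G ε y j)
      (F' := fun ε y => D ε y i * G ε y j + G ε y i * D ε y j)
      (Ioo_mem_nhds (neg_lt_zero.mpr hδ) hδ) (Filter.Eventually.of_forall fun ε =>
        ((hcoord_meas (hGmeas ε) i).mul (hcoord_meas (hGmeas ε) j)).aestronglyMeasurable)
      (hint1 i j) ?_ (hdom i j) hM ?_).2
    · exact (((hcoord_meas (hDmeas 0) i).mul (hcoord_meas (hGmeas 0) j)).add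
        ((hcoord_meas (hGmeas 0) i).mul (hcoord_meas (hDmeas 0) j))).aestronglyMeasurable
    · filter_upwards [hdiff] with y hy ε hε
      exact (hasDerivAt_pi.mp (hy ε hε) i).mul (hasDerivAt_pi.mp (hy ε hε) j)
  have hx := hasDerivAt_pi.mp (hdiffx 0 ⟨neg_lt_zero.mpr hδ, hδ⟩)
  have h_id := hasDerivAt_id (0 : ℝ)
  refine (((h_id.const_sub 1).mul h_integral).add (h_id.mul ((hx i).mul (hx j)))).congr_deriv ?_
  simp only [id_eq, Pi.mul_apply]
  ring
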